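/- Let ε be a real number with 0 < ε < 1, let n be a positive integer, and let k be an integer satisfying k ≥ 4 (ε²/2 − ε³/3)⁻¹ log(n). Then for any set V of n points in ℝ^d, there exists a map f : ℝ^d → ℝ^k such that (1 − ε)‖u − v‖² ≤ ‖f(u) − f(v)‖² ≤ (1 + ε)‖u − v‖² for all u, v ∈ V. -/

import Mathlib

open MeasureTheory ProbabilityTheory Real

/-- The standard Gaussian expectation of a chi-squared Chernoff factor, at the optimal tilt. -/
lemma hasIntegral_exp_tilted_sq {s : ℝ} (hs : -1 < s) :
    Integrable (fun x : ℝ ↦ exp (s / (2 * (1 + s)) * (x ^ 2 - (1 + s)))) (gaussianReal 0 1) ∧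
      ∫ x, exp (s / (2 * (1 + s)) * (x ^ 2 - (1 + s))) ∂(gaussianReal 0 1) =
        exp (-s / 2) * √(1 + s) := by
  have hs' : 0 < 1 + s := by linarith
  have key : ∀ x : ℝ, gaussianPDFReal 0 1 x * exp (s / (2 * (1 + s)) * (x ^ 2 - (1 + s))) =
      (√(2 * π))⁻¹ * exp (-s / 2) * exp (-(1 / (2 * (1 + s))) * x ^ 2) := by
    intro x
    simp only [gaussianPDFReal, NNReal.coe_one, mul_one, sub_zero]
    rw [mul_assoc, mul_assoc, ← exp_add, ← exp_add]
    congr 2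
    field_simp
    ring
  constructor
  · rw [gaussianReal_of_var_ne_zero 0 one_ne_zero, integrable_withDensity_iff_integrable_smul'
      (measurable_gaussianPDF _ _) (ae_of_all _ fun _ ↦ gaussianPDF_lt_top)]
    simp only [toReal_gaussianPDF, smul_eq_mul, key]
    exact (integrable_exp_neg_mul_sq (by positivity)).const_mul _
  · rw [integral_gaussianReal_eq_integral_smul one_ne_zero]
    simp only [smul_eq_mul, key]
    rw [integral_const_mul, integral_gaussian,
      show π / (1 / (2 * (1 + s))) = (2 * π) * (1 + s) by field_simp,
      sqrt_mul (by positivity : 0 ≤ 2 * π)]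
    have : √(2 * π) ≠ 0 := by positivity
    field_simp

lemma map_inner_stdGaussian {E : Type*} [NormedAddCommGroup E] [InnerProductSpace ℝ E]
    [FiniteDimensional ℝ E] [MeasurableSpace E] [BorelSpace E] {w : E} (hw : ‖w‖ = 1) :
    (stdGaussian E).map (fun x ↦ inner ℝ w x) = gaussianReal 0 1 := by
  have h := IsGaussian.map_eq_gaussianReal (μ := stdGaussian E) (innerSL ℝ w)
  rw [variance_dual_stdGaussian, integral_strongDual_stdGaussian] at h
  simpa [hw] using h

/-- The Chernoff factor comparing `∑ i, ⟪w, g i⟫ ^ 2` with its `1 + s` multiple of the mean. -/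
noncomputable def chernoffFactor {E : Type*} [NormedAddCommGroup E] [InnerProductSpace ℝ E] {k : ℕ}
    (s : ℝ) (w : E) (g : Fin k → E) : ℝ :=
  ∏ i, exp (s / (2 * (1 + s)) * (inner ℝ (‖w‖⁻¹ • w) (g i) ^ 2 - (1 + s)))

section ChernoffFactor

variable {E : Type*} [NormedAddCommGroup E] [InnerProductSpace ℝ E] {k : ℕ}

lemma chernoffFactor_nonneg (s : ℝ) (w : E) (g : Fin k → E) : 0 ≤ chernoffFactor s w g :=
  Finset.prod_nonneg fun _ _ ↦ (exp_pos _).le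

lemma chernoffFactor_neg (s : ℝ) (w : E) (g : Fin k → E) :
    chernoffFactor s (-w) g = chernoffFactor s w g := by
  simp [chernoffFactor]

lemma one_le_chernoffFactor {s : ℝ} {w : E} {g : Fin k → E} (hw : w ≠ 0)
    (h : 0 ≤ s / (2 * (1 + s)) * (∑ i, inner ℝ w (g i) ^ 2 - k * (1 + s) * ‖w‖ ^ 2)) :
    1 ≤ chernoffFactor s w g := by
  have hw' : 0 < ‖w‖ := norm_pos_iff.2 hw
  rw [chernoffFactor, ← exp_sum, one_le_exp_iff, ← Finset.mul_sum, Finset.sum_sub_distrib]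
  simp only [real_inner_smul_left, mul_pow, ← Finset.mul_sum, Finset.sum_const, Finset.card_univ,
    Fintype.card_fin, nsmul_eq_mul]
  have h₂ := mul_nonneg (by positivity : 0 ≤ (‖w‖⁻¹) ^ 2) h
  refine h₂.trans_eq ?_
  field_simp

variable [FiniteDimensional ℝ E] [MeasurableSpace E] [BorelSpace E]

lemma integral_chernoffFactor {s : ℝ} (hs : -1 < s) {w : E} (hw : w ≠ 0) :
    Integrable (chernoffFactor s w) (Measure.pi fun _ : Fin k ↦ stdGaussian E) ∧
      ∫ g, chernoffFactor s w g ∂(Measure.pi fun _ : Fin k ↦ stdGaussian E) =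
        (exp (-s / 2) * √(1 + s)) ^ k := by
  have hmap := map_inner_stdGaussian (E := E) (w := ‖w‖⁻¹ • w) (norm_smul_inv_norm (𝕜 := ℝ) hw)
  obtain ⟨hint, hval⟩ := hasIntegral_exp_tilted_sq hs
  have hmeas : AEMeasurable (fun x ↦ inner ℝ (‖w‖⁻¹ • w) x) (stdGaussian E) := by fun_prop
  rw [← hmap] at hint hval
  constructor
  · exact Integrable.fintype_prod fun _ ↦ hint.comp_aemeasurable hmeas
  · rw [integral_map hmeas hint.1] at hval
    unfold chernoffFactor
    rw [integral_fintype_prod_eq_pow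
      (fun x : E ↦ exp (s / (2 * (1 + s)) * (inner ℝ (‖w‖⁻¹ • w) x ^ 2 - (1 + s)))), hval,
      Fintype.card_fin]

end ChernoffFactor

lemma log_one_add_le_cubic {x : ℝ} (hx : 0 ≤ x) : log (1 + x) ≤ x - x ^ 2 / 2 + x ^ 3 / 3 := by
  have hmono : MonotoneOn (fun y : ℝ ↦ y - y ^ 2 / 2 + y ^ 3 / 3 - log (1 + y)) (Set.Ici 0) := by
    have hd : ∀ y : ℝ, 0 ≤ y → HasDerivAt (fun y : ℝ ↦ y - y ^ 2 / 2 + y ^ 3 / 3 - log (1 + y))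
        (1 - y + y ^ 2 - 1 / (1 + y)) y := by
      intro y hy
      have h := ((((hasDerivAt_id y).sub (((hasDerivAt_id y).pow 2).div_const 2)).add
        (((hasDerivAt_id y).pow 3).div_const 3)).sub
        (((hasDerivAt_id y).const_add 1).log (by simp; linarith)))
      refine h.congr_deriv ?_
      simp
    refine monotoneOn_of_deriv_nonneg (convex_Ici 0)
      (fun y hy ↦ (hd y hy).continuousAt.continuousWithinAt) ?_ ?_
    · intro y hy
      rw [interior_Ici] at hy
      exact (hd y (le_of_lt hy)).differentiableAt.differentiableWithinAt
    · intro y hy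
      rw [interior_Ici] at hy
      have hy : 0 < y := hy
      rw [(hd y hy.le).deriv, show 1 - y + y ^ 2 - 1 / (1 + y) = y ^ 3 / (1 + y) by
        field_simp; ring]
      positivity
  have := hmono (Set.mem_Ici.2 le_rfl) (Set.mem_Ici.2 hx) hx
  simp at this
  linarith

lemma log_one_sub_le_quadratic {x : ℝ} (hx : 0 ≤ x) (hx1 : x < 1) :
    log (1 - x) ≤ -x - x ^ 2 / 2 := by
  have hs := hasSum_pow_div_log_of_abs_lt_one (abs_lt.2 ⟨by linarith, hx1⟩)
  have := hs.summable.sum_le_tsum (Finset.range 2) (fun i _ ↦ by positivity)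
  rw [hs.tsum_eq] at this
  norm_num [Finset.sum_range_succ] at this
  linarith

lemma chernoff_rate_pow_le {s c : ℝ} {n k : ℕ} (hn : 0 < n) (hs : -1 < s) (hc : 0 < c)
    (hlog : log (1 + s) ≤ s - c) (hk : 4 * c⁻¹ * log n ≤ k) :
    (exp (-s / 2) * √(1 + s)) ^ k ≤ 1 / (n : ℝ) ^ 2 := by
  have hn' : (0 : ℝ) < n := by exact_mod_cast hn
  have hbase : exp (-s / 2) * √(1 + s) ≤ exp (-c / 2) := by
    rw [← exp_log (sqrt_pos.2 (by linarith : 0 < 1 + s)), log_sqrt (by linarith), ← exp_add]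
    exact exp_le_exp.2 (by linarith)
  calc (exp (-s / 2) * √(1 + s)) ^ k ≤ exp (-c / 2) ^ k := by gcongr
    _ = exp (k * (-c / 2)) := (exp_nat_mul _ _).symm
    _ ≤ exp (-(2 * log n)) := by
      rw [exp_le_exp]
      have h := mul_le_mul_of_nonneg_right hk hc.le
      rw [show 4 * c⁻¹ * log n * c = 4 * log n by field_simp] at h
      linarith
    _ = 1 / (n : ℝ) ^ 2 := by
      rw [exp_neg, two_mul, exp_add, exp_log hn', one_div, sq]

/-- By the first moment method, some family of vectors has all Chernoff factors of the differences
below `1`. -/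
lemma exists_chernoffFactor_lt_one {E : Type*} [NormedAddCommGroup E] [InnerProductSpace ℝ E]
    [FiniteDimensional ℝ E] {s₁ s₂ : ℝ} (hs₁ : -1 < s₁) (hs₂ : -1 < s₂) {k : ℕ} (V : Finset E)
    (hV : V.Nonempty)
    (h₁ : (exp (-s₁ / 2) * √(1 + s₁)) ^ k ≤ 1 / (V.card : ℝ) ^ 2)
    (h₂ : (exp (-s₂ / 2) * √(1 + s₂)) ^ k ≤ 1 / (V.card : ℝ) ^ 2) :
    ∃ g : Fin k → E, ∀ u ∈ V, ∀ v ∈ V, u ≠ v →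
      chernoffFactor s₁ (u - v) g < 1 ∧ chernoffFactor s₂ (u - v) g < 1 := by
  classical
  borelize E
  let μ : Measure (Fin k → E) := Measure.pi fun _ ↦ stdGaussian E
  let F : E × E → (Fin k → E) → ℝ := fun p g ↦
    chernoffFactor s₁ (p.1 - p.2) g + chernoffFactor s₂ (p.1 - p.2) g
  have hF0 : ∀ p g, 0 ≤ F p g := fun p g ↦
    add_nonneg (chernoffFactor_nonneg _ _ _) (chernoffFactor_nonneg _ _ _)
  have hF : ∀ p ∈ V.offDiag, Integrable (F p) μ ∧ ∫ g, F p g ∂μ ≤ 2 / (V.card : ℝ) ^ 2 := by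
    intro p hp
    have hne : p.1 - p.2 ≠ 0 := sub_ne_zero.2 (Finset.mem_offDiag.1 hp).2.2
    obtain ⟨hi₁, hv₁⟩ := integral_chernoffFactor (k := k) hs₁ hne
    obtain ⟨hi₂, hv₂⟩ := integral_chernoffFactor (k := k) hs₂ hne
    refine ⟨hi₁.add hi₂, ?_⟩
    rw [integral_add hi₁ hi₂, hv₁, hv₂]
    calc _ ≤ 1 / (V.card : ℝ) ^ 2 + 1 / (V.card : ℝ) ^ 2 := add_le_add h₁ h₂
      _ = _ := by ring
  obtain ⟨g, hg⟩ := exists_le_integral (μ := μ)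
    (integrable_finsetSum V.offDiag fun p hp ↦ (hF p hp).1)
  have hcard : (0 : ℝ) < V.card := by exact_mod_cast hV.card_pos
  have hlt : ∑ p ∈ V.offDiag, F p g < 2 := by
    calc ∑ p ∈ V.offDiag, F p g ≤ ∫ g, ∑ p ∈ V.offDiag, F p g ∂μ := hg
      _ = ∑ p ∈ V.offDiag, ∫ g, F p g ∂μ := integral_finsetSum _ fun p hp ↦ (hF p hp).1
      _ ≤ ∑ _p ∈ V.offDiag, 2 / (V.card : ℝ) ^ 2 := Finset.sum_le_sum fun p hp ↦ (hF p hp).2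
      _ = (V.card * V.card - V.card) * (2 / (V.card : ℝ) ^ 2) := by
        rw [Finset.sum_const, Finset.offDiag_card, nsmul_eq_mul,
          Nat.cast_sub (Nat.le_mul_self _), Nat.cast_mul]
      _ < 2 := by
        rw [mul_div_assoc', div_lt_iff₀ (by positivity)]
        nlinarith
  refine ⟨g, fun u hu v hv huv ↦ ?_⟩
  have hsymm : F (v, u) g = F (u, v) g := by
    simp only [F]
    rw [← neg_sub u v, chernoffFactor_neg, chernoffFactor_neg]
  have hpair : F (u, v) g + F (v, u) g ≤ ∑ p ∈ V.offDiag, F p g := by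
    rw [← Finset.sum_pair (f := fun p ↦ F p g) (by simp [huv] : (u, v) ≠ (v, u))]
    refine Finset.sum_le_sum_of_subset_of_nonneg ?_ fun p _ _ ↦ hF0 p g
    intro p hp
    rcases Finset.mem_insert.1 hp with rfl | hp
    · simp [hu, hv, huv]
    · rw [Finset.mem_singleton.1 hp]
      simp [hu, hv, huv.symm]
  have hlt' : F (u, v) g < 1 := by linarith
  have e₁ := chernoffFactor_nonneg s₁ (u - v) g
  have e₂ := chernoffFactor_nonneg s₂ (u - v) g
  simp only [F] at hlt'
  exact ⟨by linarith, by linarith⟩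

/-- **Johnson–Lindenstrauss lemma.** For `0 < ε < 1`, a positive integer `n`, and an
integer `k ≥ 4 (ε²/2 − ε³/3)⁻¹ log n`, any set `V` of `n` points in `ℝ^d` admits a map
`f : ℝ^d → ℝ^k` with `(1 − ε)‖u − v‖² ≤ ‖f u − f v‖² ≤ (1 + ε)‖u − v‖²` for all `u, v ∈ V`. -/
theorem stmt0 {d : ℕ} (ε : ℝ) (hε0 : 0 < ε) (hε1 : ε < 1) (n : ℕ) (hn : 0 < n)
    (k : ℕ) (hk : 4 * (ε ^ 2 / 2 - ε ^ 3 / 3)⁻¹ * Real.log n ≤ (k : ℝ))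
    (V : Finset (EuclideanSpace ℝ (Fin d))) (hV : V.card = n) :
    ∃ f : EuclideanSpace ℝ (Fin d) → EuclideanSpace ℝ (Fin k),
      ∀ u ∈ V, ∀ v ∈ V,
        (1 - ε) * ‖u - v‖ ^ 2 ≤ ‖f u - f v‖ ^ 2 ∧
          ‖f u - f v‖ ^ 2 ≤ (1 + ε) * ‖u - v‖ ^ 2 := by
  subst hV
  have hc : 0 < ε ^ 2 / 2 - ε ^ 3 / 3 := by
    have : 0 < ε ^ 2 := by positivity
    nlinarith
  have hupper : log (1 + ε) ≤ ε - (ε ^ 2 / 2 - ε ^ 3 / 3) := by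
    linarith [log_one_add_le_cubic hε0.le]
  have hlower : log (1 + -ε) ≤ -ε - (ε ^ 2 / 2 - ε ^ 3 / 3) := by
    have : 0 < ε ^ 3 := by positivity
    rw [← sub_eq_add_neg]
    linarith [log_one_sub_le_quadratic hε0.le hε1]
  obtain ⟨g, hg⟩ := exists_chernoffFactor_lt_one (by linarith : -1 < ε) (by linarith : -1 < -ε) V
    (Finset.card_pos.1 hn) (chernoff_rate_pow_le hn (by linarith) hc hupper hk)
    (chernoff_rate_pow_le hn (by linarith) hc hlower hk)
  refine ⟨fun x ↦ WithLp.toLp 2 fun i ↦ (√k)⁻¹ * inner ℝ x (g i), fun u hu v hv ↦ ?_⟩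
  rcases eq_or_ne u v with rfl | huv
  · simp
  have hk0 : (0 : ℝ) < k := by
    refine lt_of_lt_of_le ?_ hk
    have : 1 < V.card := Finset.one_lt_card.2 ⟨u, hu, v, hv, huv⟩
    have : 0 < log V.card := log_pos (by exact_mod_cast this)
    positivity
  obtain ⟨hg₁, hg₂⟩ := hg u hu v hv huv
  have huv' : u - v ≠ 0 := sub_ne_zero.2 huv
  have hnorm : ‖(WithLp.toLp 2 fun i ↦ (√k)⁻¹ * inner ℝ u (g i) : EuclideanSpace ℝ (Fin k)) -
      WithLp.toLp 2 fun i ↦ (√k)⁻¹ * inner ℝ v (g i)‖ ^ 2 =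
      (∑ i, inner ℝ (u - v) (g i) ^ 2) / k := by
    rw [EuclideanSpace.real_norm_sq_eq, Finset.sum_div]
    refine Finset.sum_congr rfl fun i _ ↦ ?_
    simp only [PiLp.sub_apply]
    rw [← mul_sub, ← inner_sub_left, mul_pow, inv_pow, sq_sqrt hk0.le]
    ring
  rw [hnorm, le_div_iff₀ hk0, div_le_iff₀ hk0]
  constructor
  · by_contra! h
    refine hg₂.not_ge (one_le_chernoffFactor huv' (mul_nonneg_of_nonpos_of_nonpos ?_ ?_))
    · exact div_nonpos_of_nonpos_of_nonneg (by linarith) (by linarith)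
    · linarith
  · by_contra! h
    refine hg₁.not_ge (one_le_chernoffFactor huv' (mul_nonneg ?_ ?_))
    · positivity
    · linarith
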